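/- Let G be a graph containing no pyramid, and let K be a prism of G with the minimum number of vertices among all prisms in G, formed by chordless paths P1, P2, P3 with triangles {a1, a2, a3} and {b1, b2, b3}, where Pi joins ai to bi. Then for each i ∈ {1, 2, 3} (subscripts mod 3): if Ri is any shortest chordless path of G from ai to bi none of whose internal vertices is adjacent to any of a_{i+1}, a_{i+2}, b_{i+1}, b_{i+2}, then Ri, P_{i+1}, P_{i+2} form a prism of G on |V(K)| vertices with triangles {a1, a2, a3} and {b1, b2, b3}. -/

import Mathlib

open SimpleGraph

/-- A prism in `G`: three vertex-disjoint chordless paths (given by embeddings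
`f i` of path graphs on `n i ≥ 2` vertices), the path `f i` going from `a i`
to `b i`, such that `{a 0, a 1, a 2}` and `{b 0, b 1, b 2}` are triangles and
there are no other edges between the paths. -/
def IsPrismConfig {V : Type} (G : SimpleGraph V) (n : Fin 3 → ℕ)
    (f : ∀ i, pathGraph (n i) ↪g G) (a b : Fin 3 → V) : Prop :=
  (∀ i, 2 ≤ n i) ∧
  (∀ i (h : 0 < n i), (f i ⟨0, h⟩ : V) = a i) ∧
  (∀ i (h : n i - 1 < n i), (f i ⟨n i - 1, h⟩ : V) = b i) ∧
  (∀ i j, i ≠ j → ∀ x y, (f i x : V) ≠ f j y) ∧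
  (∀ i j, i ≠ j → G.Adj (a i) (a j)) ∧
  (∀ i j, i ≠ j → G.Adj (b i) (b j)) ∧
  (∀ i j, i ≠ j → ∀ x y, G.Adj (f i x) (f j y) →
    ((f i x : V) = a i ∧ (f j y : V) = a j) ∨ ((f i x : V) = b i ∧ (f j y : V) = b j))

/-- `G` contains a pyramid: three chordless paths from a common apex to the
vertices of a triangle, at least two of them of length at least 2, pairwise
vertex-disjoint except at the apex and with no edges between them other than
the triangle and the edges at the apex. -/
def HasPyramid {V : Type} (G : SimpleGraph V) : Prop :=
  ∃ (n : Fin 3 → ℕ) (f : ∀ i, pathGraph (n i) ↪g G) (apex : V) (b : Fin 3 → V),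
    (∀ i, 2 ≤ n i) ∧
    (∃ i j, i ≠ j ∧ 3 ≤ n i ∧ 3 ≤ n j) ∧
    (∀ i (h : 0 < n i), (f i ⟨0, h⟩ : V) = apex) ∧
    (∀ i (h : n i - 1 < n i), (f i ⟨n i - 1, h⟩ : V) = b i) ∧
    (∀ i j, i ≠ j → G.Adj (b i) (b j)) ∧
    (∀ i j, i ≠ j → ∀ x y, (f i x : V) = f j y → (f i x : V) = apex) ∧
    (∀ i j, i ≠ j → ∀ x y, G.Adj (f i x) (f j y) →
      ((f i x : V) = b i ∧ (f j y : V) = b j) ∨ (f i x : V) = apex ∨ (f j y : V) = apex)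

/-- The vertices `p 0, …, p L` form a chordless path. -/
def IsInducedPath {V : Type} (G : SimpleGraph V) (p : ℕ → V) (L : ℕ) : Prop :=
  ∀ u v, u < v → v ≤ L → p u ≠ p v ∧ (G.Adj (p u) (p v) ↔ v = u + 1)

/-- The sequences `p 0, …, p P` and `q 0, …, q Q` are disjoint, and the only edges between
them join their first vertices and their last vertices. -/
def PrismCompatible {V : Type} (G : SimpleGraph V) (p : ℕ → V) (P : ℕ) (q : ℕ → V) (Q : ℕ) :
    Prop :=
  ∀ x y, x ≤ P → y ≤ Q →
    p x ≠ q y ∧ (G.Adj (p x) (q y) ↔ (x = 0 ∧ y = 0) ∨ (x = P ∧ y = Q))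

/-- The sequences `p 0, …, p P` and `q 0, …, q Q` share exactly their first vertex, and the only
edges between them not at that vertex join their last vertices. -/
def PyramidCompatible {V : Type} (G : SimpleGraph V) (p : ℕ → V) (P : ℕ) (q : ℕ → V) (Q : ℕ) :
    Prop :=
  (∀ x y, x ≤ P → y ≤ Q → p x = q y → x = 0 ∧ y = 0) ∧
  (∀ x y, x ≤ P → y ≤ Q → G.Adj (p x) (q y) → (x = P ∧ y = Q) ∨ x = 0 ∨ y = 0) ∧
  G.Adj (p P) (q Q)

/-- `C 0, …, C (N - 1)` is a chordless cycle. -/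
def IsInducedCycle {V : Type} (G : SimpleGraph V) (C : ℕ → V) (N : ℕ) : Prop :=
  ∀ u v, u < v → v < N →
    C u ≠ C v ∧ (G.Adj (C u) (C v) ↔ v = u + 1 ∨ (u = 0 ∧ v = N - 1))

/-- The sequence starting with `v` and continuing with `p`. -/
def consSeq {V : Type} (v : V) (p : ℕ → V) : ℕ → V
  | 0 => v
  | u + 1 => p u

lemma PrismCompatible.symm {V : Type} {G : SimpleGraph V} {p q : ℕ → V} {P Q : ℕ}
    (h : PrismCompatible G p P q Q) : PrismCompatible G q Q p P := by
  intro x y hx hy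
  have := h y x hy hx
  rw [G.adj_comm, this.2]
  exact ⟨this.1.symm, by tauto⟩

lemma PyramidCompatible.symm {V : Type} {G : SimpleGraph V} {p q : ℕ → V} {P Q : ℕ}
    (h : PyramidCompatible G p P q Q) : PyramidCompatible G q Q p P := by
  obtain ⟨h1, h2, h3⟩ := h
  refine ⟨fun x y hx hy e => (h1 y x hy hx e.symm).symm, fun x y hx hy e => ?_, h3.symm⟩
  have := h2 y x hy hx e.symm
  tauto

lemma IsInducedPath.injOn {V : Type} {G : SimpleGraph V} {p : ℕ → V} {L u v : ℕ}
    (h : IsInducedPath G p L) (hu : u ≤ L) (hv : v ≤ L) (e : p u = p v) : u = v := by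
  rcases lt_trichotomy u v with hlt | heq | hlt
  · exact absurd e (h u v hlt hv).1
  · exact heq
  · exact absurd e.symm (h v u hlt hu).1

/-- The embedding of a path graph given by a chordless path. -/
def IsInducedPath.embedding {V : Type} {G : SimpleGraph V} {p : ℕ → V} {L : ℕ}
    (h : IsInducedPath G p L) : pathGraph (L + 1) ↪g G where
  toFun x := p x
  inj' := by
    intro x y hxy
    exact Fin.ext (h.injOn (by omega) (by omega) hxy)
  map_rel_iff' := by
    intro x y
    change G.Adj (p x) (p y) ↔ _
    rw [pathGraph_adj]
    rcases lt_trichotomy (x : ℕ) y with hlt | heq | hlt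
    · rw [(h x y hlt (by omega)).2]; omega
    · rw [heq]; simp
    · rw [G.adj_comm, (h y x hlt (by omega)).2]; omega

lemma exists_isPrismConfig {V : Type} {G : SimpleGraph V} {p : Fin 3 → ℕ → V} {L : Fin 3 → ℕ}
    (hL : ∀ i, 1 ≤ L i) (hp : ∀ i, IsInducedPath G (p i) (L i))
    (h : ∀ i j, i ≠ j → PrismCompatible G (p i) (L i) (p j) (L j)) :
    ∃ f a b, IsPrismConfig G (fun i => L i + 1) f a b := by
  refine ⟨fun i => (hp i).embedding, fun i => p i 0, fun i => p i (L i),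
    fun i => Nat.succ_le_succ (hL i), fun _ _ => rfl, fun _ _ => rfl, ?_, ?_, ?_, ?_⟩
  · intro i j hij x y
    exact (h i j hij x y (Nat.le_of_lt_succ x.isLt) (Nat.le_of_lt_succ y.isLt)).1
  · intro i j hij
    exact (h i j hij 0 0 (by omega) (by omega)).2.2 (by simp)
  · intro i j hij
    exact (h i j hij _ _ le_rfl le_rfl).2.2 (by simp)
  · intro i j hij x y hadj
    change (p i x = _ ∧ p j y = _) ∨ (p i x = _ ∧ p j y = _)
    rcases (h i j hij x y (Nat.le_of_lt_succ x.isLt) (Nat.le_of_lt_succ y.isLt)).2.1 hadj with ⟨h1, h2⟩ | ⟨h1, h2⟩ <;>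
      simp [h1, h2]

lemma hasPyramid_of_compatible {V : Type} {G : SimpleGraph V} {p : Fin 3 → ℕ → V}
    {L : Fin 3 → ℕ} (apex : V) (hL : ∀ i, 1 ≤ L i) (hlong : ∃ i j, i ≠ j ∧ 2 ≤ L i ∧ 2 ≤ L j)
    (hapex : ∀ i, p i 0 = apex) (hp : ∀ i, IsInducedPath G (p i) (L i))
    (h : ∀ i j, i ≠ j → PyramidCompatible G (p i) (L i) (p j) (L j)) :
    HasPyramid G := by
  obtain ⟨i, j, hij, hi, hj⟩ := hlong
  refine ⟨fun i => L i + 1, fun i => (hp i).embedding, apex, fun i => p i (L i),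
    fun i => Nat.succ_le_succ (hL i), ⟨i, j, hij, Nat.succ_le_succ hi, Nat.succ_le_succ hj⟩,
    fun i _ => hapex i, fun _ _ => rfl, fun i j hij => (h i j hij).2.2, ?_, ?_⟩
  · intro i j hij x y hxy
    change p i x = apex
    rw [((h i j hij).1 x y (Nat.le_of_lt_succ x.isLt) (Nat.le_of_lt_succ y.isLt) hxy).1, hapex]
  · intro i j hij x y hadj
    change (p i x = _ ∧ p j y = _) ∨ p i x = apex ∨ p j y = apex
    rcases (h i j hij).2.1 x y (Nat.le_of_lt_succ x.isLt) (Nat.le_of_lt_succ y.isLt) hadj with ⟨h1, h2⟩ | h1 | h1 <;>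
      simp [*]

lemma forall_ne_fin_three {R : Fin 3 → Fin 3 → Prop} (hR : ∀ i j, R i j → R j i)
    (h01 : R 0 1) (h02 : R 0 2) (h12 : R 1 2) : ∀ i j, i ≠ j → R i j := by
  intro i j hij
  fin_cases i <;> fin_cases j <;> first | exact absurd rfl hij | assumption | (apply hR; assumption)

lemma exists_isPrismConfig_of_three {V : Type} {G : SimpleGraph V} {p q r : ℕ → V} {P Q R : ℕ}
    (hP : 1 ≤ P) (hQ : 1 ≤ Q) (hR : 1 ≤ R) (hp : IsInducedPath G p P) (hq : IsInducedPath G q Q)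
    (hr : IsInducedPath G r R) (hpq : PrismCompatible G p P q Q) (hpr : PrismCompatible G p P r R)
    (hqr : PrismCompatible G q Q r R) :
    ∃ n f a b, IsPrismConfig G n f a b ∧ ∑ i, n i = P + Q + R + 3 := by
  obtain ⟨f, a, b, h⟩ := exists_isPrismConfig (G := G) (p := ![p, q, r]) (L := ![P, Q, R])
    (by simp [Fin.forall_fin_succ, *]) (by simp [Fin.forall_fin_succ, *])
    (forall_ne_fin_three (fun _ _ => PrismCompatible.symm) hpq hpr hqr)
  refine ⟨_, f, a, b, h, ?_⟩
  simp [Fin.sum_univ_three]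
  omega

lemma hasPyramid_of_three {V : Type} {G : SimpleGraph V} {p q r : ℕ → V} {P Q R : ℕ} (apex : V)
    (hP : 1 ≤ P) (hQ : 1 ≤ Q) (hR : 1 ≤ R)
    (hlong : (2 ≤ P ∧ 2 ≤ Q) ∨ (2 ≤ P ∧ 2 ≤ R) ∨ (2 ≤ Q ∧ 2 ≤ R))
    (hp0 : p 0 = apex) (hq0 : q 0 = apex) (hr0 : r 0 = apex)
    (hp : IsInducedPath G p P) (hq : IsInducedPath G q Q) (hr : IsInducedPath G r R)
    (hpq : PyramidCompatible G p P q Q) (hpr : PyramidCompatible G p P r R)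
    (hqr : PyramidCompatible G q Q r R) : HasPyramid G := by
  refine hasPyramid_of_compatible (G := G) (p := ![p, q, r]) (L := ![P, Q, R]) apex
    (by simp [Fin.forall_fin_succ, *]) ?_ (by simp [Fin.forall_fin_succ, *])
    (by simp [Fin.forall_fin_succ, *])
    (forall_ne_fin_three (fun _ _ => PyramidCompatible.symm) hpq hpr hqr)
  rcases hlong with h | h | h
  · exact ⟨0, 1, by simp, h⟩
  · exact ⟨0, 2, by simp, h⟩
  · exact ⟨1, 2, by simp, h⟩

lemma IsInducedPath.reverse {V : Type} {G : SimpleGraph V} {p : ℕ → V} {L : ℕ}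
    (h : IsInducedPath G p L) : IsInducedPath G (fun u => p (L - u)) L := by
  intro u v huv hv
  have := h (L - v) (L - u) (by omega) (by omega)
  refine ⟨this.1.symm, ?_⟩
  rw [G.adj_comm, this.2]
  omega

lemma IsInducedPath.cons {V : Type} {G : SimpleGraph V} {p : ℕ → V} {L : ℕ} {v : V}
    (h : IsInducedPath G p L) (hv : ∀ u ≤ L, v ≠ p u ∧ (G.Adj v (p u) ↔ u = 0)) :
    IsInducedPath G (consSeq v p) (L + 1) := by
  intro x y hxy hy
  obtain ⟨y, rfl⟩ : ∃ z, y = z + 1 := ⟨y - 1, by omega⟩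
  cases x with
  | zero => simpa [consSeq] using hv y (by omega)
  | succ x => simpa [consSeq] using h x y (by omega) (by omega)

lemma IsInducedCycle.initial_path {V : Type} {G : SimpleGraph V} {C : ℕ → V} {N s : ℕ}
    (hC : IsInducedCycle G C N) (hs : s + 2 ≤ N) : IsInducedPath G C s := by
  intro u v huv hv
  have := hC u v huv (by omega)
  refine ⟨this.1, this.2.trans ?_⟩
  omega

lemma IsInducedCycle.final_path {V : Type} {G : SimpleGraph V} {C : ℕ → V} {N t : ℕ}
    (hC : IsInducedCycle G C N) (ht : 1 ≤ t) :
    IsInducedPath G (fun u => C (t + u)) (N - 1 - t) := by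
  intro u v huv hv
  have := hC (t + u) (t + v) (by omega) (by omega)
  refine ⟨this.1, this.2.trans ?_⟩
  omega

/-- A path starting at a vertex complete to an edge of a chordless cycle, whose last vertex is
the only other one with neighbours on the cycle, yields a pyramid or a prism. -/
lemma exists_prism_of_path_to_cycle {V : Type} {G : SimpleGraph V} (hpyr : ¬ HasPyramid G)
    {C q : ℕ → V} {N k s t : ℕ} (hC : IsInducedCycle G C N) (hN : 4 ≤ N)
    (hq : IsInducedPath G q k) (hk : 1 ≤ k) (hdisj : ∀ u j, u ≤ k → j < N → q u ≠ C j)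
    (hstart : ∀ j < N, G.Adj (q 0) (C j) ↔ j = 0 ∨ j = N - 1)
    (hmid : ∀ u j, 0 < u → u < k → j < N → ¬ G.Adj (q u) (C j))
    (hs : 1 ≤ s) (hst : s ≤ t) (ht : t + 2 ≤ N)
    (hend : ∀ j < N, G.Adj (q k) (C j) → s ≤ j ∧ j ≤ t)
    (hadj_s : G.Adj (q k) (C s)) (hadj_t : G.Adj (q k) (C t)) :
    ∃ n f a b, IsPrismConfig G n f a b ∧ ∑ i, n i = k + 1 + N := by
  have hne : ∀ u v, u < N → v < N → C u = C v → u = v := by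
    intro u v hu hv e
    rcases lt_trichotomy u v with h | h | h
    · exact absurd e (hC u v h hv).1
    · exact h
    · exact absurd e.symm (hC v u h hu).1
  have hqC : ∀ u j, u ≤ k → j < N → G.Adj (q u) (C j) →
      (u = 0 ∧ (j = 0 ∨ j = N - 1)) ∨ (u = k ∧ s ≤ j ∧ j ≤ t) := by
    intro u j hu hj h
    rcases Nat.eq_zero_or_pos u with rfl | h0
    · exact Or.inl ⟨rfl, (hstart j hj).1 h⟩
    · rcases hu.eq_or_lt with rfl | hlt
      · exact Or.inr ⟨rfl, hend j hj h⟩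
      · exact absurd h (hmid u j h0 hlt hj)
  have hwrap : G.Adj (C 0) (C (N - 1)) :=
    (hC 0 (N - 1) (by omega) (by omega)).2.2 (by simp)
  have h0 : G.Adj (q 0) (C 0) := (hstart 0 (by omega)).2 (by simp)
  have h1 : G.Adj (q 0) (C (N - 1)) := (hstart (N - 1) (by omega)).2 (by simp)
  have hpre := hC.initial_path (s := s) (by omega)
  have hsuf := hC.final_path (t := t) (by omega)
  rcases hst.eq_or_lt with rfl | hlt
  · refine absurd (hasPyramid_of_three (P := s) (Q := N - 1 - s) (R := k + 1)
      (p := fun u => C (s - u)) (q := fun u => C (s + u))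
      (r := consSeq (C s) (fun u => q (k - u))) (C s) (by omega) (by omega) (by omega)
      (by omega) rfl rfl rfl hpre.reverse hsuf (hq.reverse.cons ?_) ⟨?_, ?_, ?_⟩
      ⟨?_, ?_, ?_⟩ ⟨?_, ?_, ?_⟩) hpyr
    · intro u hu
      refine ⟨(hdisj (k - u) s (by omega) (by omega)).symm, fun h => ?_, ?_⟩
      · have := hqC (k - u) s (by omega) (by omega) h.symm
        omega
      · rintro rfl
        exact hadj_s.symm
    · intro x y hx hy e
      have := hne _ _ (by omega) (by omega) e
      omega
    · intro x y hx hy e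
      by_cases hxy : x = 0 ∨ y = 0
      · exact Or.inr hxy
      · have := (hC (s - x) (s + y) (by omega) (by omega)).2.1 e
        omega
    · simpa [show s + (N - 1 - s) = N - 1 by omega] using hwrap
    · intro x y hx hy e
      cases y with
      | zero =>
        have := hne _ _ (by omega) (by omega) e
        omega
      | succ y => exact absurd e.symm (hdisj (k - y) (s - x) (by omega) (by omega))
    · intro x y hx hy e
      cases y with
      | zero => simp
      | succ y =>
        have := hqC (k - y) (s - x) (by omega) (by omega) (G.adj_symm e)
        omega
    · simpa [consSeq] using h0.symm
    · intro x y hx hy e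
      cases y with
      | zero =>
        have := hne _ _ (by omega) (by omega) e
        omega
      | succ y => exact absurd e.symm (hdisj (k - y) (s + x) (by omega) (by omega))
    · intro x y hx hy e
      cases y with
      | zero => simp
      | succ y =>
        have := hqC (k - y) (s + x) (by omega) (by omega) (G.adj_symm e)
        omega
    · simpa [consSeq, show s + (N - 1 - s) = N - 1 by omega] using h1.symm
  rcases (Nat.succ_le_of_lt hlt).eq_or_lt with rfl | hlt'
  · rw [show k + 1 + N = s + (N - 1 - (s + 1)) + k + 3 by omega]
    refine exists_isPrismConfig_of_three (p := C)
      (q := fun u => C (s + 1 + (N - 1 - (s + 1) - u))) (r := q) hs (by omega) hk hpre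
      hsuf.reverse hq ?_ ?_ ?_
    · intro x y hx hy
      have := hC x (s + 1 + (N - 1 - (s + 1) - y)) (by omega) (by omega)
      refine ⟨this.1, this.2.trans ?_⟩
      omega
    · intro x y hx hy
      refine ⟨(hdisj y x hy (by omega)).symm, fun h => ?_, ?_⟩
      · have := hqC y x hy (by omega) h.symm
        omega
      · rintro (⟨rfl, rfl⟩ | ⟨rfl, rfl⟩)
        · exact h0.symm
        · exact hadj_s.symm
    · intro x y hx hy
      refine ⟨(hdisj y _ hy (by omega)).symm, fun h => ?_, ?_⟩
      · have := hqC y _ hy (by omega) h.symm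
        omega
      · rintro (⟨rfl, rfl⟩ | ⟨rfl, rfl⟩)
        · simpa [show s + 1 + (N - 1 - (s + 1)) = N - 1 by omega] using h1.symm
        · simpa using hadj_t.symm
  · refine absurd (hasPyramid_of_three (P := s + 1) (Q := N - 1 - t + 1) (R := k)
      (p := consSeq (q k) (fun u => C (s - u))) (q := consSeq (q k) (fun u => C (t + u)))
      (r := fun u => q (k - u)) (q k) (by omega) (by omega) (by omega)
      (by omega) rfl rfl rfl (hpre.reverse.cons ?_) (hsuf.cons ?_) hq.reverse ⟨?_, ?_, ?_⟩
      ⟨?_, ?_, ?_⟩ ⟨?_, ?_, ?_⟩) hpyr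
    · intro u hu
      refine ⟨hdisj k _ le_rfl (by omega), fun h => ?_, ?_⟩
      · have := hend _ (by omega) h
        omega
      · rintro rfl
        exact hadj_s
    · intro u hu
      refine ⟨hdisj k _ le_rfl (by omega), fun h => ?_, ?_⟩
      · have := hend _ (by omega) h
        omega
      · rintro rfl
        exact hadj_t
    · intro x y hx hy e
      rcases x with _ | x <;> rcases y with _ | y
      · simp
      · exact absurd e (hdisj k (t + y) le_rfl (by omega))
      · exact absurd e.symm (hdisj k (s - x) le_rfl (by omega))
      · have := hne (s - x) (t + y) (by omega) (by omega) e
        omega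
    · intro x y hx hy e
      rcases x with _ | x <;> rcases y with _ | y
      · simp
      · simp
      · simp
      · have := (hC (s - x) (t + y) (by omega) (by omega)).2.1 e
        omega
    · simpa [consSeq, show t + (N - 1 - t) = N - 1 by omega] using hwrap
    · intro x y hx hy e
      rcases x with _ | x
      · by_contra hy0
        exact (hq (k - y) k (by omega) le_rfl).1 e.symm
      · exact absurd e.symm (hdisj (k - y) (s - x) (by omega) (by omega))
    · intro x y hx hy e
      rcases x with _ | x
      · simp
      · have := hqC (k - y) (s - x) (by omega) (by omega) (G.adj_symm e)
        omega
    · simpa [consSeq] using h0.symm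
    · intro x y hx hy e
      rcases x with _ | x
      · by_contra hy0
        exact (hq (k - y) k (by omega) le_rfl).1 e.symm
      · exact absurd e.symm (hdisj (k - y) (t + x) (by omega) (by omega))
    · intro x y hx hy e
      rcases x with _ | x
      · simp
      · have := hqC (k - y) (t + x) (by omega) (by omega) (G.adj_symm e)
        omega
    · simpa [consSeq, show t + (N - 1 - t) = N - 1 by omega] using h1.symm

/-- Two compatible paths `p` and `q` close up to a chordless cycle. -/
lemma PrismCompatible.isInducedCycle {V : Type} {G : SimpleGraph V} {p q : ℕ → V} {P Q : ℕ}
    (hp : IsInducedPath G p P) (hq : IsInducedPath G q Q) (h : PrismCompatible G p P q Q) :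
    IsInducedCycle G (fun u => if u ≤ P then p u else q (P + Q + 1 - u)) (P + Q + 2) := by
  intro u v huv hv
  by_cases hvP : v ≤ P
  · have := hp u v huv hvP
    simp only [hvP, if_true, show u ≤ P by omega]
    exact ⟨this.1, this.2.trans (by omega)⟩
  · by_cases huP : u ≤ P
    · have := h u (P + Q + 1 - v) huP (by omega)
      simp only [hvP, huP, if_true, if_false]
      exact ⟨this.1, this.2.trans (by omega)⟩
    · have := hq (P + Q + 1 - v) (P + Q + 1 - u) (by omega) (by omega)
      simp only [hvP, huP, if_false]
      rw [G.adj_comm, this.2]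
      exact ⟨this.1.symm, by omega⟩

/-- In a pyramid-free graph, a path joining the remaining corners of a prism frame, with interior
not adjacent to the other corners, completes it to a prism unless a smaller prism exists. -/
lemma prismCompatible_of_minimal {V : Type} {G : SimpleGraph V} (hpyr : ¬ HasPyramid G)
    {p q r : ℕ → V} {P Q M : ℕ} (hM : 1 ≤ M) (hP : 1 ≤ P) (hQ : 1 ≤ Q)
    (hp : IsInducedPath G p P) (hq : IsInducedPath G q Q) (hr : IsInducedPath G r M)
    (hpq : PrismCompatible G p P q Q)
    (hp0 : ∀ y ≤ P, r 0 ≠ p y ∧ (G.Adj (r 0) (p y) ↔ y = 0))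
    (hq0 : ∀ y ≤ Q, r 0 ≠ q y ∧ (G.Adj (r 0) (q y) ↔ y = 0))
    (hp1 : ∀ y ≤ P, r M ≠ p y ∧ (G.Adj (r M) (p y) ↔ y = P))
    (hq1 : ∀ y ≤ Q, r M ≠ q y ∧ (G.Adj (r M) (q y) ↔ y = Q))
    (hint : ∀ x, 0 < x → x < M → ¬ G.Adj (r x) (p 0) ∧ ¬ G.Adj (r x) (q 0))
    (hmin : ∀ n f a b, IsPrismConfig G n f a b → M + P + Q + 3 ≤ ∑ i, n i) :
    PrismCompatible G r M p P ∧ PrismCompatible G r M q Q := by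
  set C : ℕ → V := fun u => if u ≤ P then p u else q (P + Q + 1 - u) with hCdef
  have hC : IsInducedCycle G C (P + Q + 2) := hpq.isInducedCycle hp hq
  have hCp : ∀ y ≤ P, C y = p y := fun y hy => if_pos hy
  have hCq : ∀ y ≤ Q, C (P + Q + 1 - y) = q y := fun y hy => by
    simp only [hCdef]
    rw [if_neg (by omega)]
    congr 1
    omega
  have hcases : ∀ {R : ℕ → Prop}, (∀ y ≤ P, R y) → (∀ y ≤ Q, R (P + Q + 1 - y)) →
      ∀ j < P + Q + 2, R j := by
    intro R h1 h2 j hj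
    by_cases hjP : j ≤ P
    · exact h1 j hjP
    · have := h2 (P + Q + 1 - j) (by omega)
      rwa [show P + Q + 1 - (P + Q + 1 - j) = j by omega] at this
  have hC0 : ∀ j < P + Q + 2, r 0 ≠ C j ∧ (G.Adj (r 0) (C j) ↔ j = 0 ∨ j = P + Q + 1) := by
    refine hcases ?_ ?_
    · intro y hy
      rw [hCp y hy, (hp0 y hy).2]
      exact ⟨(hp0 y hy).1, by omega⟩
    · intro y hy
      rw [hCq y hy, (hq0 y hy).2]
      exact ⟨(hq0 y hy).1, by omega⟩
  have hfirst : C 0 = p 0 := hCp 0 (by omega)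
  have hlast : C (P + Q + 1) = q 0 := hCq 0 (by omega)
  have hwrap : G.Adj (C 0) (C (P + Q + 1)) :=
    (hC 0 (P + Q + 1) (by omega) (by omega)).2.2 (by simp)
  -- an interior vertex on the cycle forces an earlier interior vertex with a neighbour on it
  have hdisj : ∀ x < M, (∀ u j, 0 < u → u < x → j < P + Q + 2 → ¬ G.Adj (r u) (C j)) →
      ∀ j < P + Q + 2, r x ≠ C j := by
    intro x hx hno j hj e
    rcases x with _ | x
    · exact (hC0 j hj).1 e
    have hadj : G.Adj (r x) (C j) := e ▸ (hr x (x + 1) (by omega) (by omega)).2.2 rfl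
    rcases Nat.eq_zero_or_pos x with rfl | hx0
    · rcases (hC0 j hj).2.1 hadj with rfl | rfl
      · exact (hint 1 (by omega) hx).2 (by rw [e, ← hlast]; exact hwrap)
      · exact (hint 1 (by omega) hx).1 (by rw [e, ← hfirst]; exact hwrap.symm)
    · exact hno x j hx0 (by omega) hj hadj
  have hnone : ∀ x, 0 < x → x < M → ∀ j < P + Q + 2, ¬ G.Adj (r x) (C j) := by
    intro x
    induction x using Nat.strong_induction_on with
    | _ k ih =>
      intro hk hkM j hj hadj
      have hbound : ∀ j < P + Q + 2, G.Adj (r k) (C j) → 1 ≤ j ∧ j ≤ P + Q := by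
        intro j hj h
        have h1 : j ≠ 0 := by
          rintro rfl
          exact (hint k hk hkM).1 (hfirst ▸ h)
        have h2 : j ≠ P + Q + 1 := by
          rintro rfl
          exact (hint k hk hkM).2 (hlast ▸ h)
        omega
      classical
      let S := (Finset.range (P + Q + 2)).filter fun j => G.Adj (r k) (C j)
      have hS : S.Nonempty := ⟨j, by simp [S, hj, hadj]⟩
      have hmem : ∀ {j}, j ∈ S ↔ j < P + Q + 2 ∧ G.Adj (r k) (C j) := by simp [S]
      have hs := hmem.1 (S.min'_mem hS)
      have ht := hmem.1 (S.max'_mem hS)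
      have hsb := hbound _ hs.1 hs.2
      have htb := hbound _ ht.1 ht.2
      obtain ⟨n, f, a, b, hprism, hn⟩ := exists_prism_of_path_to_cycle hpyr hC (by omega)
        (fun u v huv hv => hr u v huv (by omega) : IsInducedPath G r k) hk
        (fun u j hu hj => hdisj u (by omega)
          (fun v j h0 hv hj => ih v (by omega) h0 (by omega) j hj) j hj)
        (fun j hj => (hC0 j hj).2) (fun u j h0 hu hj => ih u hu h0 (by omega) j hj)
        hsb.1 (S.min'_le_max' hS) (by omega)
        (fun j hj h => ⟨S.min'_le j (hmem.2 ⟨hj, h⟩), S.le_max' j (hmem.2 ⟨hj, h⟩)⟩) hs.2 ht.2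
      have := hmin n f a b hprism
      omega
  have hinterior : ∀ x, 0 < x → x < M → ∀ j < P + Q + 2, r x ≠ C j ∧ ¬ G.Adj (r x) (C j) :=
    fun x h0 hx j hj => ⟨hdisj x hx (fun u j h0 hu hj => hnone u h0 (by omega) j hj) j hj,
      hnone x h0 hx j hj⟩
  constructor
  · intro x y hx hy
    rcases Nat.eq_zero_or_pos x with rfl | h0
    · exact ⟨(hp0 y hy).1, (hp0 y hy).2.trans (by omega)⟩
    rcases hx.eq_or_lt with rfl | hlt
    · exact ⟨(hp1 y hy).1, (hp1 y hy).2.trans (by omega)⟩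
    have := hinterior x h0 hlt y (by omega)
    rw [hCp y hy] at this
    exact ⟨this.1, iff_of_false this.2 (by omega)⟩
  · intro x y hx hy
    rcases Nat.eq_zero_or_pos x with rfl | h0
    · exact ⟨(hq0 y hy).1, (hq0 y hy).2.trans (by omega)⟩
    rcases hx.eq_or_lt with rfl | hlt
    · exact ⟨(hq1 y hy).1, (hq1 y hy).2.trans (by omega)⟩
    have := hinterior x h0 hlt (P + Q + 1 - y) (by omega)
    rw [hCq y hy] at this
    exact ⟨this.1, iff_of_false this.2 (by omega)⟩

/-- The sequence of vertices of an embedded path graph. -/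
def pathSeq {V : Type} {G : SimpleGraph V} {L : ℕ} (g : pathGraph L ↪g G) (hL : 0 < L) (u : ℕ) :
    V :=
  g ⟨min u (L - 1), by omega⟩

lemma pathSeq_eq {V : Type} {G : SimpleGraph V} {L : ℕ} (g : pathGraph L ↪g G) (hL : 0 < L)
    {u : ℕ} (hu : u < L) : pathSeq g hL u = g ⟨u, hu⟩ := by
  unfold pathSeq
  congr 2
  omega

lemma isInducedPath_pathSeq {V : Type} {G : SimpleGraph V} {L : ℕ} (g : pathGraph L ↪g G)
    (hL : 0 < L) : IsInducedPath G (pathSeq g hL) (L - 1) := by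
  intro u v huv hv
  rw [pathSeq_eq g hL (show u < L by omega), pathSeq_eq g hL (show v < L by omega)]
  refine ⟨fun h => ?_, ?_⟩
  · have := g.injective h
    simp at this
    omega
  · rw [g.map_adj_iff, pathGraph_adj]
    simp only
    omega

/-- In a pyramid-free graph `G`, let `K` be a prism with the minimum number of
vertices among all prisms of `G`, with paths `f i` from `a i` to `b i`.  If `g`
is a shortest chordless path from `a i` to `b i` none of whose internal vertices
is adjacent to any of the corners of the other two paths, then replacing the
path `f i` by `g` again yields a prism with the same triangles and the same
number of vertices. -/
theorem minimum_prism_shortest_path {V : Type} [Fintype V] (G : SimpleGraph V)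
    (hpyr : ¬ HasPyramid G)
    (n : Fin 3 → ℕ) (f : ∀ i, pathGraph (n i) ↪g G) (a b : Fin 3 → V)
    (hK : IsPrismConfig G n f a b)
    (hmin : ∀ (n' : Fin 3 → ℕ) (f' : ∀ i, pathGraph (n' i) ↪g G)
        (a' b' : Fin 3 → V), IsPrismConfig G n' f' a' b' → ∑ i, n i ≤ ∑ i, n' i)
    (i : Fin 3) (m : ℕ) (hm : 2 ≤ m) (g : pathGraph m ↪g G)
    (hga : (g ⟨0, by omega⟩ : V) = a i) (hgb : (g ⟨m - 1, by omega⟩ : V) = b i)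
    (hgint : ∀ x : Fin m, x.val ≠ 0 → x.val ≠ m - 1 →
        ∀ j, j ≠ i → ¬ G.Adj (g x) (a j) ∧ ¬ G.Adj (g x) (b j))
    (hshort : ∀ (m' : ℕ) (hm' : 2 ≤ m') (g' : pathGraph m' ↪g G),
        (g' ⟨0, by omega⟩ : V) = a i → (g' ⟨m' - 1, by omega⟩ : V) = b i →
        (∀ x : Fin m', x.val ≠ 0 → x.val ≠ m' - 1 →
            ∀ j, j ≠ i → ¬ G.Adj (g' x) (a j) ∧ ¬ G.Adj (g' x) (b j)) →
        m ≤ m') :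
    m = n i ∧
    (∀ j, j ≠ i → ∀ x y, (g x : V) ≠ f j y) ∧
    (∀ j, j ≠ i → ∀ x y, G.Adj (g x) (f j y) →
        ((g x : V) = a i ∧ (f j y : V) = a j) ∨
        ((g x : V) = b i ∧ (f j y : V) = b j)) := by
  obtain ⟨hn, hfa, hfb, hdisj, haa, hbb, hcross⟩ := hK
  obtain ⟨j, k, hij, hik, hjk, hall⟩ :
      ∃ j k, i ≠ j ∧ i ≠ k ∧ j ≠ k ∧ ∀ l, l ≠ i → l = j ∨ l = k := by
    clear * -
    decide +revert
  have hsum : ∑ l, n l = n i + n j + n k := by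
    have huniv : (Finset.univ : Finset (Fin 3)) = {i, j, k} := by
      clear * - hij hik hjk
      decide +revert
    rw [huniv, Finset.sum_insert (by simp [hij, hik]), Finset.sum_pair hjk, add_assoc]
  have hpos : ∀ l, 0 < n l := fun l => by have := hn l; omega
  have hni := hn i
  have hnj := hn j
  have hnk := hn k
  set F : Fin 3 → ℕ → V := fun l => pathSeq (f l) (hpos l)
  have hFeq : ∀ l u (hu : u < n l), F l u = f l ⟨u, hu⟩ := fun l u hu => pathSeq_eq _ _ hu
  have hF0 : ∀ l, F l 0 = a l := fun l => (hFeq l 0 (hpos l)).trans (hfa l _)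
  have hF1 : ∀ l, F l (n l - 1) = b l := fun l =>
    (hFeq l _ (Nat.sub_lt (hpos l) one_pos)).trans (hfb l _)
  have hpath : ∀ l, IsInducedPath G (F l) (n l - 1) := fun l => isInducedPath_pathSeq _ _
  have hcompat : ∀ l l', l ≠ l' → PrismCompatible G (F l) (n l - 1) (F l') (n l' - 1) := by
    intro l l' hl x y hx hy
    have hl0 := hpos l
    have hl0' := hpos l'
    refine ⟨?_, fun h => ?_, ?_⟩
    · rw [hFeq l x (by omega), hFeq l' y (by omega)]
      exact hdisj l l' hl _ _
    · have := hcross l l' hl ⟨x, by omega⟩ ⟨y, by omega⟩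
        (by rwa [← hFeq, ← hFeq])
      rw [← hFeq, ← hFeq] at this
      refine this.imp (fun h => ?_) (fun h => ?_)
      · rw [← hF0 l, ← hF0 l'] at h
        exact ⟨(hpath l).injOn hx (by omega) h.1, (hpath l').injOn hy (by omega) h.2⟩
      · rw [← hF1 l, ← hF1 l'] at h
        exact ⟨(hpath l).injOn hx le_rfl h.1, (hpath l').injOn hy le_rfl h.2⟩
    · rintro (⟨rfl, rfl⟩ | ⟨rfl, rfl⟩)
      · rw [hF0, hF0]
        exact haa l l' hl
      · rw [hF1, hF1]
        exact hbb l l' hl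
  have hmle : m ≤ n i := by
    refine hshort (n i) hni (f i) (hfa i _) (hfb i _) fun x hx0 hx1 l hl => ?_
    have hnl := hn l
    have hx := hFeq i x x.isLt
    constructor
    · intro h
      rw [← hF0 l] at h
      have := (hcompat i l hl.symm x 0 (by omega) (by omega)).2.1 (hx ▸ h)
      omega
    · intro h
      rw [← hF1 l] at h
      have := (hcompat i l hl.symm x (n l - 1) (by omega) le_rfl).2.1 (hx ▸ h)
      omega
  set r : ℕ → V := pathSeq g (by omega)
  have hreq : ∀ u (hu : u < m), r u = g ⟨u, hu⟩ := fun u hu => pathSeq_eq _ _ hu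
  have hr0 : r 0 = F i 0 := by rw [hreq 0 (by omega), hga, hF0]
  have hr1 : r (m - 1) = F i (n i - 1) := by rw [hreq (m - 1) (by omega), hgb, hF1]
  have hrpath : IsInducedPath G r (m - 1) := isInducedPath_pathSeq _ _
  have hstart : ∀ l, l ≠ i → ∀ y ≤ n l - 1, r 0 ≠ F l y ∧ (G.Adj (r 0) (F l y) ↔ y = 0) := by
    intro l hl y hy
    rw [hr0]
    have := hcompat i l hl.symm 0 y (by omega) hy
    exact ⟨this.1, this.2.trans (by omega)⟩
  have hend : ∀ l, l ≠ i → ∀ y ≤ n l - 1,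
      r (m - 1) ≠ F l y ∧ (G.Adj (r (m - 1)) (F l y) ↔ y = n l - 1) := by
    intro l hl y hy
    rw [hr1]
    have := hcompat i l hl.symm (n i - 1) y le_rfl hy
    exact ⟨this.1, this.2.trans (by omega)⟩
  have hint : ∀ x, 0 < x → x < m - 1 → ∀ l, l ≠ i → ¬ G.Adj (r x) (F l 0) := by
    intro x hx0 hx1 l hl
    rw [hreq x (by omega), hF0]
    exact (hgint _ (by simp only; omega) (by simp only; omega) l hl).1
  obtain ⟨hrj, hrk⟩ := prismCompatible_of_minimal hpyr (by omega) (by omega) (by omega)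
    (hpath j) (hpath k) hrpath (hcompat j k hjk) (hstart j hij.symm) (hstart k hik.symm)
    (hend j hij.symm) (hend k hik.symm)
    (fun x h0 h1 => ⟨hint x h0 h1 j hij.symm, hint x h0 h1 k hik.symm⟩)
    (fun n' f' a' b' h => by
      have := hmin n' f' a' b' h
      omega)
  have hrl : ∀ l, l ≠ i → PrismCompatible G r (m - 1) (F l) (n l - 1) := by
    intro l hl
    rcases hall l hl with rfl | rfl
    · exact hrj
    · exact hrk
  refine ⟨?_, fun l hl x y => ?_, fun l hl x y hadj => ?_⟩
  · obtain ⟨n', f', a', b', h, hn'⟩ := exists_isPrismConfig_of_three (by omega) (by omega)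
      (by omega) hrpath (hpath j) (hpath k) hrj hrk (hcompat j k hjk)
    have := hmin n' f' a' b' h
    omega
  · have := (hrl l hl x y (by omega) (by omega)).1
    rwa [hreq x x.isLt, hFeq l y y.isLt] at this
  · rw [← hreq x x.isLt, ← hFeq l y y.isLt] at hadj ⊢
    rcases (hrl l hl x y (by omega) (by omega)).2.1 hadj with ⟨h1, h2⟩ | ⟨h1, h2⟩
    · left
      rw [h1, h2, hr0, hF0, hF0]
      exact ⟨rfl, rfl⟩
    · right
      rw [h1, h2, hr1, hF1, hF1]
      exact ⟨rfl, rfl⟩
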